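/- arXiv:2109.09936 — 2 statements merged into one kernel-verified Lean document; each statement's English description precedes it below -/
import Mathlib

section
/- Let x : Ω → ℝᵖ and ε : Ω → ℝ be independent random elements on a probability space, let B ∈ ℝ^{p×k}, let f : ℝᵏ × ℝ → ℝ be measurable, and define y = f(Bᵀx, ε). Then y and x are conditionally independent given Bᵀx, i.e., y ⟂ x | Bᵀx (conditional independence with respect to the σ-algebra generated by the random vector Bᵀx). -/
open MeasureTheory ProbabilityTheory Matrix

/-- General version: `y = F (φ x, ε)` with `x` and `ε` independent. -/
theorem condIndepFun_aux {Ω α β γ δ : Type*} [mΩ : MeasurableSpace Ω] [StandardBorelSpace Ω]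
    [MeasurableSpace α] [mβ : MeasurableSpace β] [MeasurableSpace γ] [MeasurableSpace δ]
    (μ : Measure Ω) [IsProbabilityMeasure μ] (x : Ω → α) (ε : Ω → γ) (φ : α → β)
    (F : β × γ → δ) (hx : Measurable x) (hε : Measurable ε) (hφ : Measurable φ)
    (hF : Measurable F) (hindep : IndepFun x ε μ)
    (hm : MeasurableSpace.comap (fun ω => φ (x ω)) mβ ≤ mΩ) :
    CondIndepFun (MeasurableSpace.comap (fun ω => φ (x ω)) mβ) hm
      (fun ω => F (φ (x ω), ε ω)) x μ := by
  have hy : Measurable (fun ω => F (φ (x ω), ε ω)) := by fun_prop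
  rw [condIndepFun_iff_condExp_inter_preimage_eq_mul hy hx]
  intro s t hs ht
  set y := fun ω => F (φ (x ω), ε ω) with hydef
  have hν : IsProbabilityMeasure (μ.map ε) := Measure.isProbabilityMeasure_map hε.aemeasurable
  set ν := μ.map ε with hνdef
  have hS : MeasurableSet (F ⁻¹' s) := hF hs
  let g : β → ℝ := fun b => ν.real (Prod.mk b ⁻¹' (F ⁻¹' s))
  have hg : Measurable g := (measurable_measure_prodMk_left hS).ennreal_toReal
  let h : Ω → ℝ := fun ω => g (φ (x ω))
  have hhm : Measurable h := hg.comp (hφ.comp hx)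
  have hbd : ∀ ω, ‖h ω‖ ≤ 1 := fun ω => by
    rw [Real.norm_of_nonneg measureReal_nonneg]
    exact measureReal_le_one
  have hhint : Integrable h μ :=
    Integrable.of_bound hhm.aestronglyMeasurable 1 (Filter.Eventually.of_forall hbd)
  have hyint : Integrable ((y ⁻¹' s).indicator (fun _ => (1 : ℝ))) μ :=
    (integrable_const 1).indicator (hy hs)
  have hxint : Integrable ((x ⁻¹' t).indicator (fun _ => (1 : ℝ))) μ :=
    (integrable_const 1).indicator (hx ht)
  -- conditional expectation given `x`
  have hkey : h =ᵐ[μ] μ[(y ⁻¹' s).indicator (fun _ => (1 : ℝ)) | MeasurableSpace.comap x inferInstance] := by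
    refine ae_eq_condExp_of_forall_setIntegral_eq hx.comap_le hyint
      (fun _ _ _ => hhint.integrableOn) ?_ ?_
    · rintro _ ⟨u, hu, rfl⟩ -
      have h1 : μ (y ⁻¹' s ∩ x ⁻¹' u) =
          ∫⁻ ω in x ⁻¹' u, ν (Prod.mk (φ (x ω)) ⁻¹' (F ⁻¹' s)) ∂μ := by
        let T : Set (α × γ) := (fun q : α × γ => F (φ q.1, q.2)) ⁻¹' s ∩ Prod.fst ⁻¹' u
        have hT : MeasurableSet T := by
          refine MeasurableSet.inter (Measurable.comp hF (by fun_prop) hs) (measurable_fst hu)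
        have e1 : μ (y ⁻¹' s ∩ x ⁻¹' u) = μ.map (fun ω => (x ω, ε ω)) T := by
          rw [Measure.map_apply (hx.prodMk hε) hT]; rfl
        rw [e1, (indepFun_iff_map_prod_eq_prod_map_map hx.aemeasurable hε.aemeasurable).1 hindep,
          Measure.prod_apply hT, lintegral_map (measurable_measure_prodMk_left hT) hx,
          ← lintegral_indicator (hx hu)]
        refine lintegral_congr fun ω => ?_
        by_cases hω : x ω ∈ u
        · rw [Set.indicator_of_mem (show ω ∈ x ⁻¹' u from hω)]
          congr 1
          ext e
          simp [T, hω]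
        · rw [Set.indicator_of_notMem (show ω ∉ x ⁻¹' u from hω)]
          have : Prod.mk (x ω) ⁻¹' T = ∅ := by
            ext e
            simp [T, hω]
          rw [this, measure_empty]
      rw [setIntegral_indicator (hy hs), setIntegral_const, smul_eq_mul, mul_one, Set.inter_comm,
        Measure.real, h1]
      exact integral_toReal
        (((measurable_measure_prodMk_left hS).comp (hφ.comp hx)).aemeasurable)
        (Filter.Eventually.of_forall fun _ => measure_lt_top _ _)
    · exact ((hg.comp hφ).comp (comap_measurable x)).stronglyMeasurable.aestronglyMeasurable
  have hle : MeasurableSpace.comap (fun ω => φ (x ω)) mβ ≤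
      MeasurableSpace.comap x inferInstance := by
    rintro _ ⟨u, hu, rfl⟩
    exact ⟨φ ⁻¹' u, hφ hu, rfl⟩
  have hhz : StronglyMeasurable[MeasurableSpace.comap (fun ω => φ (x ω)) mβ] h :=
    (hg.comp (comap_measurable (fun ω => φ (x ω)))).stronglyMeasurable
  have hY : μ[(y ⁻¹' s).indicator (fun _ => (1 : ℝ)) |
      MeasurableSpace.comap (fun ω => φ (x ω)) mβ] =ᵐ[μ] h := by
    refine (condExp_condExp_of_le hle hx.comap_le).symm.trans ?_
    refine (condExp_congr_ae hkey.symm).trans ?_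
    rw [condExp_of_stronglyMeasurable hm hhz hhint]
  have hYX : μ[(y ⁻¹' s ∩ x ⁻¹' t).indicator (fun _ => (1 : ℝ)) |
      MeasurableSpace.comap (fun ω => φ (x ω)) mβ] =ᵐ[μ]
      h * μ[(x ⁻¹' t).indicator (fun _ => (1 : ℝ)) |
      MeasurableSpace.comap (fun ω => φ (x ω)) mβ] := by
    have e : (x ⁻¹' t).indicator h = h * (x ⁻¹' t).indicator (fun _ => (1 : ℝ)) := by
      ext ω
      by_cases hω : ω ∈ x ⁻¹' t <;> simp [Set.indicator, hω]
    refine (condExp_condExp_of_le hle hx.comap_le).symm.trans ?_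
    refine (condExp_congr_ae (g := (x ⁻¹' t).indicator h) ?_).trans ?_
    · rw [Set.inter_comm, ← Set.indicator_indicator]
      refine (condExp_indicator hyint (comap_measurable x ht)).trans ?_
      filter_upwards [hkey] with ω hω
      simp only [Set.indicator, hω]
    · rw [e]
      refine condExp_mul_of_stronglyMeasurable_left hhz ?_ hxint
      rw [← e]
      exact hhint.indicator (hx ht)
  filter_upwards [hY, hYX] with ω h1 h2
  rw [h1, h2, Pi.mul_apply]

/-- **The general index model gives conditional independence.**
If `x` and `ε` are independent, `B ∈ ℝ^{p×k}`, `f` is measurable, and `y = f(Bᵀx, ε)`,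
then `y` and `x` are conditionally independent given `Bᵀx` (i.e. given the σ-algebra
generated by the random vector `Bᵀx`). -/
theorem condIndep_of_index_model
    {Ω : Type*} [MeasurableSpace Ω] [StandardBorelSpace Ω]
    (μ : Measure Ω) [IsProbabilityMeasure μ]
    {p k : ℕ}
    (x : Ω → Fin p → ℝ) (ε : Ω → ℝ)
    (hx : Measurable x) (hε : Measurable ε)
    (hindep : IndepFun x ε μ)
    (B : Matrix (Fin p) (Fin k) ℝ)
    (f : (Fin k → ℝ) → ℝ → ℝ)
    (hf : Measurable (fun q : (Fin k → ℝ) × ℝ => f q.1 q.2))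
    (y : Ω → ℝ) (hy : ∀ ω, y ω = f (Bᵀ.mulVec (x ω)) (ε ω))
    (hBx : Measurable (fun ω => Bᵀ.mulVec (x ω))) :
    CondIndepFun (MeasurableSpace.comap (fun ω => Bᵀ.mulVec (x ω)) inferInstance)
      hBx.comap_le y x μ := by
  obtain rfl : y = fun ω => f (Bᵀ.mulVec (x ω)) (ε ω) := funext hy
  have hφ : Measurable (fun v : Fin p → ℝ => Bᵀ.mulVec v) :=
    (Continuous.matrix_mulVec continuous_const continuous_id).measurable
  exact condIndepFun_aux μ x ε (fun v => Bᵀ.mulVec v) (fun q => f q.1 q.2) hx hε hφ hf hindep _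
end

section
/- Let u₀ be a p-dimensional random vector whose law is invariant under every orthogonal transformation of ℝᵖ, let A ∈ ℝ^{p×p} be invertible, and set x = A u₀. Assume E‖x‖₂² < ∞ and E x = 0, and let Σ = Var(x). Let B ∈ ℝ^{p×k} be such that BᵀΣB is invertible. Then the conditional expectation of x given Bᵀx is linear in Bᵀx: E( x | Bᵀx ) = Σ B (BᵀΣB)⁻¹ Bᵀx almost surely. -/
open MeasureTheory Matrix

lemma ell_inv_integral {Ω : Type*} [MeasurableSpace Ω] (μ : Measure Ω)
    {p : ℕ} (u : Ω → Fin p → ℝ) (hu : Measurable u)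
    (Q : Matrix (Fin p) (Fin p) ℝ)
    (hQ : μ.map (fun ω => Q.mulVec (u ω)) = μ.map u)
    (f : (Fin p → ℝ) → ℝ) (hf : Measurable f) :
    ∫ ω, f (Q.mulVec (u ω)) ∂μ = ∫ ω, f (u ω) ∂μ := by
  have hm : Measurable (fun ω => Q.mulVec (u ω)) :=
    (Continuous.matrix_mulVec continuous_const continuous_id).measurable.comp hu
  rw [← integral_map (f := f) hm.aemeasurable hf.aestronglyMeasurable, hQ,
    integral_map hu.aemeasurable hf.aestronglyMeasurable]

lemma ell_second_moment {Ω : Type*} [MeasurableSpace Ω] (μ : Measure Ω)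
    {p : ℕ} (u : Ω → Fin p → ℝ) (hu : Measurable u)
    (hinv : ∀ Q : Matrix (Fin p) (Fin p) ℝ, Qᵀ * Q = 1 →
      μ.map (fun ω => Q.mulVec (u ω)) = μ.map u) :
    ∃ c : ℝ, (Matrix.of fun i j => ∫ ω, u ω i * u ω j ∂μ) = c • (1 : Matrix (Fin p) (Fin p) ℝ) := by
  have hoff : ∀ i j, i ≠ j → ∫ ω, u ω i * u ω j ∂μ = 0 := by
    intro i j hij
    let d : Fin p → ℝ := fun l => if l = i then -1 else 1
    have h := ell_inv_integral μ u hu (diagonal d) (hinv _ (by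
      rw [diagonal_transpose, diagonal_mul_diagonal, ← diagonal_one]
      congr 1; ext l; simp only [d]; split_ifs <;> simp)) (fun v => v i * v j) (by fun_prop)
    simp only [mulVec_diagonal, d, if_true, if_neg hij.symm] at h
    have h2 : ∫ ω, -1 * u ω i * (1 * u ω j) ∂μ = - ∫ ω, u ω i * u ω j ∂μ := by
      rw [← integral_neg]; congr 1; ext ω; ring
    linarith
  have hdiag : ∀ i j, ∫ ω, u ω i * u ω i ∂μ = ∫ ω, u ω j * u ω j ∂μ := by
    intro i j
    have h := ell_inv_integral μ u hu ((Equiv.swap i j).toPEquiv.toMatrix) (hinv _ (by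
      rw [← PEquiv.toMatrix_symm, ← PEquiv.toMatrix_trans, ← Equiv.toPEquiv_symm,
        ← Equiv.toPEquiv_trans]
      simp)) (fun v => v j * v j) (by fun_prop)
    simpa [PEquiv.toMatrix_toPEquiv_mulVec] using h
  rcases Nat.eq_zero_or_pos p with h0 | h0
  · subst h0
    exact ⟨0, Subsingleton.elim _ _⟩
  · refine ⟨∫ ω, u ω ⟨0, h0⟩ * u ω ⟨0, h0⟩ ∂μ, ?_⟩
    ext i j
    by_cases hij : i = j
    · subst hij; simpa using hdiag _ _
    · simpa [hij] using hoff i j hij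

/-- **Linearity of the conditional expectation under elliptical symmetry
(consequence of the design condition 3.1).**
If `x = A u₀` with `A` invertible and the law of `u₀` invariant under every orthogonal
transformation of `ℝᵖ`, `x` is square integrable with mean zero and covariance `Σ`, and
`BᵀΣB` is invertible, then `E(x | Bᵀx) = Σ B (BᵀΣB)⁻¹ Bᵀ x` almost surely. -/
theorem elliptical_linear_condExp
    {Ω : Type*} [MeasurableSpace Ω] (μ : Measure Ω) [IsProbabilityMeasure μ]
    {p k : ℕ}
    (u₀ : Ω → Fin p → ℝ) (hu₀ : Measurable u₀)
    (hinv : ∀ Q : Matrix (Fin p) (Fin p) ℝ, Qᵀ * Q = 1 →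
      μ.map (fun ω => Q.mulVec (u₀ ω)) = μ.map u₀)
    (A : Matrix (Fin p) (Fin p) ℝ) (hA : IsUnit A)
    (x : Ω → Fin p → ℝ) (hx : ∀ ω, x ω = A.mulVec (u₀ ω))
    (hL2 : Integrable (fun ω => ∑ i, (x ω i) ^ 2) μ)
    (hmean : ∀ i, ∫ ω, x ω i ∂μ = 0)
    (Sig : Matrix (Fin p) (Fin p) ℝ)
    (hSig : Sig = fun i j => ∫ ω, x ω i * x ω j ∂μ)
    (B : Matrix (Fin p) (Fin k) ℝ)
    (hB : IsUnit (Bᵀ * Sig * B)) :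
    ∀ j : Fin p,
      μ[(fun ω => x ω j) |
          MeasurableSpace.comap (fun ω => Bᵀ.mulVec (x ω)) inferInstance]
        =ᵐ[μ] fun ω => (Sig * B * (Bᵀ * Sig * B)⁻¹ * Bᵀ).mulVec (x ω) j := by
  classical
  -- integrability
  have hxm : Measurable x := by
    have : x = fun ω => A.mulVec (u₀ ω) := funext hx
    rw [this]
    exact (Continuous.matrix_mulVec continuous_const continuous_id).measurable.comp hu₀
  have hxi : ∀ i, Measurable fun ω => x ω i := fun i => (measurable_pi_apply i).comp hxm
  have hxL2 : ∀ i, MemLp (fun ω => x ω i) 2 μ := by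
    intro i
    rw [memLp_two_iff_integrable_sq (hxi i).aestronglyMeasurable]
    refine hL2.mono' ((hxi i).pow_const 2).aestronglyMeasurable (Filter.Eventually.of_forall ?_)
    intro ω
    rw [Real.norm_of_nonneg (sq_nonneg _)]
    exact Finset.single_le_sum (f := fun i => (x ω i) ^ 2) (fun _ _ => sq_nonneg _)
      (Finset.mem_univ i)
  have hAdet : IsUnit A.det := (Matrix.isUnit_iff_isUnit_det A).1 hA
  have hux : ∀ ω, u₀ ω = A⁻¹.mulVec (x ω) := by
    intro ω
    rw [hx, mulVec_mulVec, nonsing_inv_mul _ hAdet, one_mulVec]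
  have huL2 : ∀ i, MemLp (fun ω => u₀ ω i) 2 μ := by
    intro i
    have : (fun ω => u₀ ω i) = fun ω => ∑ l, A⁻¹ i l * x ω l := by
      ext ω; rw [hux]; rfl
    rw [this]
    exact memLp_finsetSum _ fun l _ => (hxL2 l).const_mul _
  have huu : ∀ i j, Integrable (fun ω => u₀ ω i * u₀ ω j) μ := fun i j =>
    (huL2 i).integrable_mul (huL2 j)
  have hMint : ∀ (N : Matrix (Fin p) (Fin p) ℝ) (j : Fin p),
      Integrable (fun ω => N.mulVec (x ω) j) μ := by
    intro N j
    have : (fun ω => N.mulVec (x ω) j) = fun ω => ∑ l, N j l * x ω l := rfl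
    rw [this]
    exact integrable_finsetSum _ fun l _ => ((hxL2 l).integrable (by norm_num)).const_mul _
  -- covariance
  obtain ⟨c, hc⟩ := ell_second_moment μ u₀ hu₀ hinv
  have hSigA : Sig = c • (A * Aᵀ) := by
    have h1 : Sig = A * (Matrix.of fun i j => ∫ ω, u₀ ω i * u₀ ω j ∂μ) * Aᵀ := by
      rw [hSig]
      ext i j
      have h2 : ∀ ω, x ω i * x ω j
          = ∑ b, ∑ a, A i a * (u₀ ω a * u₀ ω b) * A j b := by
        intro ω
        rw [hx]
        simp only [mulVec, dotProduct]
        rw [Finset.sum_mul_sum, Finset.sum_comm]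
        refine Finset.sum_congr rfl fun b _ => Finset.sum_congr rfl fun a _ => by ring
      simp only [h2]
      rw [integral_finsetSum _ fun b _ => integrable_finsetSum _ fun a _ =>
        ((huu a b).const_mul _).mul_const _]
      simp only [mul_apply, transpose_apply, of_apply, Finset.sum_mul]
      refine Finset.sum_congr rfl fun b _ => ?_
      rw [integral_finsetSum _ fun a _ => ((huu a b).const_mul _).mul_const _]
      refine Finset.sum_congr rfl fun a _ => ?_
      rw [integral_mul_const, integral_const_mul]
    rw [h1, hc]
    simp
  set G := Bᵀ * Sig * B with hG
  have hGdet : IsUnit G.det := (Matrix.isUnit_iff_isUnit_det G).1 hB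
  have hSigT : Sigᵀ = Sig := by
    rw [hSigA]; simp [transpose_mul]
  have hGT : Gᵀ = G := by
    rw [hG]; simp only [transpose_mul, transpose_transpose, hSigT, Matrix.mul_assoc]
  set M := Sig * B * G⁻¹ * Bᵀ with hM
  have hBM : Bᵀ * M = Bᵀ := by
    have : Bᵀ * M = G * G⁻¹ * Bᵀ := by rw [hM, hG]; simp only [Matrix.mul_assoc]
    rw [this, mul_nonsing_inv _ hGdet, Matrix.one_mul]
  have hMM : M * M = M := by
    calc M * M = Sig * B * G⁻¹ * (Bᵀ * M) := by
          conv_lhs => rw [hM]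
          rw [← hM, Matrix.mul_assoc _ Bᵀ M]
      _ = M := by rw [hBM]
  set N := A⁻¹ * M * A with hN
  have hAN : A * N = M * A := by
    rw [hN, ← Matrix.mul_assoc, ← Matrix.mul_assoc, mul_nonsing_inv _ hAdet, Matrix.one_mul]
  have hNN : N * N = N := by
    calc N * N = A⁻¹ * M * (A * N) := (Matrix.mul_assoc (A⁻¹ * M) A N)
      _ = A⁻¹ * (M * M) * A := by rw [hAN]; simp only [Matrix.mul_assoc]
      _ = N := by rw [hMM]
  have hN' : N = c • (Aᵀ * B * G⁻¹ * Bᵀ * A) := by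
    have : A⁻¹ * Sig = c • Aᵀ := by
      rw [hSigA, Matrix.mul_smul, ← Matrix.mul_assoc, nonsing_inv_mul _ hAdet, Matrix.one_mul]
    calc N = (A⁻¹ * Sig) * (B * G⁻¹ * Bᵀ * A) := by rw [hN, hM]; simp only [Matrix.mul_assoc]
      _ = _ := by rw [this, Matrix.smul_mul]; simp only [Matrix.mul_assoc]
  have hNT : Nᵀ = N := by
    rw [hN']
    simp only [transpose_smul, transpose_mul, transpose_transpose, transpose_nonsing_inv, hGT,
      Matrix.mul_assoc]
  set Q : Matrix (Fin p) (Fin p) ℝ := N + N - 1 with hQ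
  have hQQ : Qᵀ * Q = 1 := by
    have : Qᵀ = Q := by rw [hQ]; simp [hNT]
    rw [this, hQ]
    simp only [Matrix.mul_sub, Matrix.sub_mul, Matrix.mul_add, Matrix.add_mul, hNN,
      Matrix.mul_one, Matrix.one_mul]
    abel
  have hAQ : A * Q = (M + M - 1) * A := by
    rw [hQ]; simp only [Matrix.mul_sub, Matrix.sub_mul, Matrix.mul_add, Matrix.add_mul, hAN,
      Matrix.mul_one, Matrix.one_mul]
  intro j
  have hmB : Measurable fun ω => Bᵀ.mulVec (x ω) :=
    (Continuous.matrix_mulVec continuous_const continuous_id).measurable.comp hxm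
  have hle : MeasurableSpace.comap (fun ω => Bᵀ.mulVec (x ω)) inferInstance ≤ ‹MeasurableSpace Ω› :=
    hmB.comap_le
  have hxint : Integrable (fun ω => x ω j) μ := (hxL2 j).integrable (by norm_num)
  symm
  refine ae_eq_condExp_of_forall_setIntegral_eq hle hxint
    (fun s _ _ => (hMint M j).integrableOn) ?_ ?_
  · rintro t ⟨s, hs, rfl⟩ -
    have ht : MeasurableSet ((fun ω => Bᵀ.mulVec (x ω)) ⁻¹' s) := hmB hs
    let f : (Fin p → ℝ) → ℝ := fun v =>
      ((fun v : Fin p → ℝ => Bᵀ.mulVec (A.mulVec v)) ⁻¹' s).indicator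
        (fun v => M.mulVec (A.mulVec v) j - A.mulVec v j) v
    have hmulm : ∀ {m n : ℕ} (C : Matrix (Fin m) (Fin n) ℝ), Measurable fun v => C.mulVec v :=
      fun C => (Continuous.matrix_mulVec continuous_const continuous_id).measurable
    have hf : Measurable f := by
      refine Measurable.indicator ?_ (((hmulm _).comp (hmulm _)) hs)
      exact ((measurable_pi_apply j).comp ((hmulm M).comp (hmulm A))).sub
        ((measurable_pi_apply j).comp (hmulm A))
    have hfQ : ∀ v, f (Q.mulVec v) = - f v := by
      intro v
      have e1 : A.mulVec (Q.mulVec v) = (M + M - 1).mulVec (A.mulVec v) := by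
        rw [mulVec_mulVec, hAQ, mulVec_mulVec]
      have e2 : Bᵀ.mulVec (A.mulVec (Q.mulVec v)) = Bᵀ.mulVec (A.mulVec v) := by
        rw [e1, mulVec_mulVec]
        congr 1
        simp only [Matrix.mul_sub, Matrix.mul_add, hBM, Matrix.mul_one]
        abel
      have e3 : M.mulVec (A.mulVec (Q.mulVec v)) = M.mulVec (A.mulVec v) := by
        rw [e1, mulVec_mulVec]
        congr 1
        simp only [Matrix.mul_sub, Matrix.mul_add, hMM, Matrix.mul_one]
        abel
      simp only [f, Set.indicator, Set.mem_preimage, e2, e3]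
      split_ifs
      · rw [e1, sub_mulVec, add_mulVec, one_mulVec]
        simp only [Pi.sub_apply, Pi.add_apply]
        ring
      · simp
    have hI := ell_inv_integral μ u₀ hu₀ Q (hinv Q hQQ) f hf
    simp only [hfQ, integral_neg] at hI
    have hI0 : ∫ ω, f (u₀ ω) ∂μ = 0 := by linarith
    have hI1 : ∫ ω in (fun ω => Bᵀ.mulVec (x ω)) ⁻¹' s, (M.mulVec (x ω) j - x ω j) ∂μ = 0 := by
      rw [← integral_indicator ht, ← hI0]
      congr 1
      ext ω
      simp only [f, Set.indicator, Set.mem_preimage, hx]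
    rw [integral_sub (hMint M j).integrableOn hxint.integrableOn] at hI1
    linarith
  · refine StronglyMeasurable.aestronglyMeasurable (Measurable.stronglyMeasurable ?_)
    have : (fun ω => M.mulVec (x ω) j)
        = (fun w => (Sig * B * G⁻¹).mulVec w j) ∘ (fun ω => Bᵀ.mulVec (x ω)) := by
      ext ω
      simp only [Function.comp, mulVec_mulVec, hM]
    rw [this]
    refine Measurable.comp ?_ (comap_measurable _)
    exact (measurable_pi_apply j).comp
      (Continuous.matrix_mulVec continuous_const continuous_id).measurable
end
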